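/- arXiv:2106.00509 — 3 statements merged into one kernel-verified Lean document; each statement's English description precedes it below -/
import Mathlib

section
/- Let m ≥ 1 be a natural number and let X₁, …, X_m be independent real-valued random variables, each distributed according to the Gaussian distribution with mean 0 and variance 1/m (these are the m = kn nonzero entries, with 0 < k < 1, of a random vector in ℝⁿ all of whose other entries are zero). Then for every δ ∈ (0,1), Pr( |∑_{i=1}^m X_i² − 1| ≥ δ ) ≤ 2·exp(−m·δ²/16). -/
open MeasureTheory ProbabilityTheory Real
open scoped NNReal ENNReal

lemma aux_integral (v : ℝ≥0) (hv : v ≠ 0) (t : ℝ) (ht : 2 * t * v < 1) :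
    ∫ x, Real.exp (t * x ^ 2) ∂(gaussianReal 0 v) = √(1 / (1 - 2 * t * v)) := by
  have hv' : (0 : ℝ) < v := by positivity
  rw [integral_gaussianReal_eq_integral_smul hv]
  have h1 : ∀ x : ℝ, gaussianPDFReal 0 v x • Real.exp (t * x ^ 2)
      = (√(2 * π * v))⁻¹ * Real.exp (-((1 - 2 * t * v) / (2 * v)) * x ^ 2) := by
    intro x
    rw [gaussianPDFReal, smul_eq_mul, mul_assoc, ← Real.exp_add]
    congr 2
    field_simp
    ring
  simp_rw [h1]
  rw [integral_const_mul, integral_gaussian, ← Real.sqrt_inv, ← Real.sqrt_mul (by positivity)]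
  congr 1
  have : 1 - 2 * t * (v : ℝ) ≠ 0 := by linarith
  field_simp

lemma aux_bound (u : ℝ) (h1 : -(1 / 4) ≤ u) (h2 : u ≤ 1 / 4) :
    √(1 / (1 - u)) ≤ Real.exp (u / 2 + 2 / 3 * u ^ 2) := by
  have hp : 0 < 1 - u := by linarith
  apply Real.sqrt_le_iff.2
  refine ⟨by positivity, ?_⟩
  rw [← Real.exp_nat_mul, one_div, ← Real.exp_log (inv_pos.2 hp)]
  apply Real.exp_le_exp.2
  rw [Real.log_inv]
  have h3 := Real.one_sub_inv_le_log_of_pos hp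
  have h4 : (1 - u)⁻¹ - 1 ≤ u + 4 / 3 * u ^ 2 := by
    rw [sub_le_iff_le_add, inv_le_iff_one_le_mul₀ hp]
    nlinarith [mul_nonneg (sq_nonneg u) (sub_nonneg.2 h2)]
  push_cast
  linarith

lemma aux_mgf {Ω : Type*} [MeasureSpace Ω] [IsProbabilityMeasure (ℙ : Measure Ω)]
    (m : ℕ) (hm : 1 ≤ m) (X : Fin m → Ω → ℝ)
    (hmeas : ∀ i, Measurable (X i))
    (hindep : iIndepFun X ℙ)
    (hlaw : ∀ i, Measure.map (X i) ℙ = gaussianReal 0 ((m : ℝ≥0))⁻¹)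
    (u : ℝ) (h1 : -(1 / 4) ≤ u) (h2 : u ≤ 1 / 4) :
    Integrable (fun ω => Real.exp (m * u / 2 * ∑ i, (X i ω) ^ 2)) ℙ ∧
    mgf (fun ω => ∑ i, (X i ω) ^ 2) ℙ (m * u / 2) ≤ Real.exp (m * (u / 2 + 2 / 3 * u ^ 2)) := by
  have hm0 : (m : ℝ) ≠ 0 := by positivity
  have hmgf : ∀ i, mgf (fun ω => (X i ω) ^ 2) ℙ (m * u / 2) = √(1 / (1 - u)) := by
    intro i
    have e : 2 * (m * u / 2) * (((m : ℝ≥0)⁻¹ : ℝ≥0) : ℝ) = u := by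
      push_cast; field_simp
    have h := aux_integral ((m : ℝ≥0)⁻¹) (by positivity) (m * u / 2) (by rw [e]; linarith)
    rw [e, ← hlaw i, integral_map (hmeas i).aemeasurable (by fun_prop)] at h
    exact h
  have hpos : 0 < √(1 / (1 - u)) := Real.sqrt_pos.2 (by apply one_div_pos.2; linarith)
  have hind : iIndepFun (fun i ω => (X i ω) ^ 2) ℙ :=
    hindep.comp (fun _ x => x ^ 2) (fun _ => by fun_prop)
  have hs : (fun ω => ∑ i, (X i ω) ^ 2) = ∑ i, (fun ω => (X i ω) ^ 2) := by
    ext ω; simp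
  have hM : mgf (fun ω => ∑ i, (X i ω) ^ 2) ℙ (m * u / 2) = √(1 / (1 - u)) ^ m := by
    rw [hs, hind.mgf_sum (fun i => (hmeas i).pow_const 2)]
    simp [hmgf]
  constructor
  · apply Integrable.of_integral_ne_zero
    change mgf (fun ω => ∑ i, (X i ω) ^ 2) ℙ (m * u / 2) ≠ 0
    rw [hM]
    positivity
  · rw [hM, Real.exp_nat_mul]
    exact pow_le_pow_left₀ hpos.le (aux_bound u h1 h2) m

/-- Concentration of the squared norm of a sparse Gaussian vector: if `X₁, …, X_m` are
independent Gaussians with mean `0` and variance `1/m`, then for every `δ ∈ (0,1)`,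
`Pr(|∑ X_i² − 1| ≥ δ) ≤ 2·exp(−m·δ²/16)`. -/
theorem sum_sq_gaussian_concentration
    {Ω : Type*} [MeasureSpace Ω] [IsProbabilityMeasure (ℙ : Measure Ω)]
    (m : ℕ) (hm : 1 ≤ m) (X : Fin m → Ω → ℝ)
    (hmeas : ∀ i, Measurable (X i))
    (hindep : iIndepFun X ℙ)
    (hlaw : ∀ i, Measure.map (X i) ℙ = gaussianReal 0 ((m : ℝ≥0))⁻¹)
    (δ : ℝ) (hδ : δ ∈ Set.Ioo (0 : ℝ) 1) :
    ℙ {ω | δ ≤ |(∑ i, (X i ω) ^ 2) - 1|} ≤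
      ENNReal.ofReal (2 * Real.exp (-(m * δ ^ 2) / 16)) := by
  obtain ⟨h0, h1⟩ := hδ
  obtain ⟨i1, b1⟩ := aux_mgf m hm X hmeas hindep hlaw (δ / 4) (by linarith) (by linarith)
  obtain ⟨i2, b2⟩ := aux_mgf m hm X hmeas hindep hlaw (-(δ / 4)) (by linarith) (by linarith)
  have hm0 : (0 : ℝ) ≤ m := by positivity
  have hq : 0 ≤ (m : ℝ) * δ ^ 2 := by positivity
  have c1 := measure_ge_le_exp_mul_mgf (μ := ℙ) (X := fun ω => ∑ i, (X i ω) ^ 2)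
    (1 + δ) (t := m * (δ / 4) / 2) (by positivity) i1
  have c2 := measure_le_le_exp_mul_mgf (μ := ℙ) (X := fun ω => ∑ i, (X i ω) ^ 2)
    (1 - δ) (t := m * (-(δ / 4)) / 2) (by nlinarith) i2
  have d1 := c1.trans (mul_le_mul_of_nonneg_left b1 (Real.exp_nonneg _))
  have d2 := c2.trans (mul_le_mul_of_nonneg_left b2 (Real.exp_nonneg _))
  rw [← Real.exp_add] at d1 d2
  have e1 := d1.trans (Real.exp_le_exp.2 (show _ ≤ -(m * δ ^ 2) / 16 by nlinarith))
  have e2 := d2.trans (Real.exp_le_exp.2 (show _ ≤ -(m * δ ^ 2) / 16 by nlinarith))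
  rw [← ofReal_measureReal]
  apply ENNReal.ofReal_le_ofReal
  have hsub : {ω | δ ≤ |(∑ i, (X i ω) ^ 2) - 1|} ⊆
      {ω | 1 + δ ≤ ∑ i, (X i ω) ^ 2} ∪ {ω | ∑ i, (X i ω) ^ 2 ≤ 1 - δ} := by
    intro ω hω
    rcases le_abs.1 (show δ ≤ |(∑ i, (X i ω) ^ 2) - 1| from hω) with h | h
    · left; change 1 + δ ≤ _; linarith
    · right; change _ ≤ 1 - δ; linarith
  have f := (measureReal_mono (μ := (ℙ : Measure Ω)) hsub).trans (measureReal_union_le _ _)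
  linarith
end

section
/- Let m ≥ 1 be a natural number and let X₁, …, X_m, Y₁, …, Y_m be 2m jointly independent real-valued random variables, each distributed according to the Gaussian distribution with mean 0 and variance 1/m (these are the m = kn nonzero entries, with 0 < k < 1, of each of two random vectors in ℝⁿ whose other entries are zero). Then for every t with 0 ≤ t ≤ 1, Pr( |∑_{i=1}^m X_i·Y_i| ≥ t ) ≤ 2·exp( −m·t²/(4 + 2t) ). -/
open MeasureTheory ProbabilityTheory Real
open scoped NNReal ENNReal


lemma gauss_sq_aux {v : ℝ≥0} (hv : v ≠ 0) {b : ℝ} (hb : 0 < 1 - (v : ℝ) * b) :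
    Integrable (fun x : ℝ => rexp (b * x ^ 2 / 2)) (gaussianReal 0 v) ∧
    ∫ x, rexp (b * x ^ 2 / 2) ∂(gaussianReal 0 v) = (√(1 - v * b))⁻¹ := by
  have hv' : (0 : ℝ) < v := by positivity
  have key : ∀ x : ℝ, gaussianPDFReal 0 v x • rexp (b * x ^ 2 / 2)
      = (√(2 * π * v))⁻¹ * rexp (-((1 - v * b) / (2 * v)) * x ^ 2) := by
    intro x
    rw [gaussianPDFReal, smul_eq_mul, mul_assoc, ← Real.exp_add]
    congr 2
    field_simp
    ring
  have hc : 0 < (1 - v * b) / (2 * v) := by positivity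
  constructor
  · rw [gaussianReal_of_var_ne_zero _ hv, integrable_withDensity_iff_integrable_smul'
      (measurable_gaussianPDF _ _) (ae_of_all _ fun _ ↦ gaussianPDF_lt_top)]
    simp_rw [toReal_gaussianPDF, key]
    exact (integrable_exp_neg_mul_sq hc).const_mul _
  · rw [integral_gaussianReal_eq_integral_smul hv]
    simp_rw [key]
    rw [integral_const_mul, integral_gaussian, ← Real.sqrt_inv, ← Real.sqrt_inv, ← Real.sqrt_mul (by positivity)]
    congr 1
    field_simp

lemma gauss_prod_aux {v : ℝ≥0} (hv : v ≠ 0) {s : ℝ} (hb : 0 < 1 - (v : ℝ) * (v * s ^ 2)) :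
    Integrable (fun p : ℝ × ℝ => rexp (s * (p.1 * p.2))) ((gaussianReal 0 v).prod (gaussianReal 0 v)) ∧
    ∫ p : ℝ × ℝ, rexp (s * (p.1 * p.2)) ∂((gaussianReal 0 v).prod (gaussianReal 0 v))
      = (√(1 - v * (v * s ^ 2)))⁻¹ := by
  obtain ⟨h1, h2⟩ := gauss_sq_aux hv hb
  have inner : ∀ x : ℝ, ∫ y, rexp (s * (x * y)) ∂(gaussianReal 0 v) = rexp (v * s ^ 2 * x ^ 2 / 2) := by
    intro x
    have := congrFun (mgf_fun_id_gaussianReal (μ := 0) (v := v)) (s * x)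
    simp only [mgf] at this
    simp_rw [← mul_assoc, this]
    congr 1; ring
  have hint : Integrable (fun p : ℝ × ℝ => rexp (s * (p.1 * p.2)))
      ((gaussianReal 0 v).prod (gaussianReal 0 v)) := by
    rw [integrable_prod_iff (by fun_prop)]
    constructor
    · refine ae_of_all _ fun x => ?_
      simpa [mul_assoc] using integrable_exp_mul_gaussianReal (μ := 0) (v := v) (s * x)
    · simpa [inner] using h1
  refine ⟨hint, ?_⟩
  rw [integral_prod _ hint]
  simp_rw [inner]
  exact h2

lemma mgf_mul_aux {Ω : Type*} [MeasurableSpace Ω] {P : Measure Ω} [IsProbabilityMeasure P]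
    {X Y : Ω → ℝ} (hX : Measurable X) (hY : Measurable Y) (h : IndepFun X Y P) {v : ℝ≥0} (hv : v ≠ 0)
    (lX : P.map X = gaussianReal 0 v) (lY : P.map Y = gaussianReal 0 v)
    {s : ℝ} (hb : 0 < 1 - (v : ℝ) * (v * s ^ 2)) :
    Integrable (fun ω => rexp (s * (X ω * Y ω))) P ∧
    mgf (fun ω => X ω * Y ω) P s = (√(1 - v * (v * s ^ 2)))⁻¹ := by
  have hm := h.map_prod_eq_prod_map_map hX.aemeasurable hY.aemeasurable
  rw [lX, lY] at hm
  obtain ⟨h1, h2⟩ := gauss_prod_aux hv hb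
  rw [← hm] at h1 h2
  constructor
  · have hc : AEMeasurable (fun ω => (X ω, Y ω)) P := by fun_prop
    exact (integrable_map_measure (g := fun p : ℝ × ℝ => rexp (s * (p.1 * p.2)))
      (by fun_prop) hc).1 h1
  · rw [← h2, integral_map (by fun_prop) (by fun_prop)]
    rfl

lemma sqrt_bound_aux {x : ℝ} (h0 : 0 ≤ x) (h1 : x ≤ 1 / 4) : (√(1 - x))⁻¹ ≤ rexp x := by
  rw [← Real.sqrt_inv, Real.sqrt_le_left (by positivity), ← Real.exp_nat_mul]
  rw [inv_le_iff_one_le_mul₀ (by linarith)]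
  have := Real.add_one_le_exp ((2 : ℕ) * x)
  push_cast at this ⊢
  nlinarith

lemma indep_curry_aux {ι κ Ω : Type*} [MeasurableSpace Ω] {P : Measure Ω}
    {Z : ι → κ → Ω → ℝ} (mZ : ∀ i j, Measurable (Z i j))
    (h : iIndepFun (fun (p : ι × κ) ω => Z p.1 p.2 ω) P) :
    iIndepFun (fun i ω => (Z i · ω)) P := by
  have := h.isProbabilityMeasure
  have : ∀ i j, IsProbabilityMeasure (P.map (Z i j)) :=
    fun i j ↦ Measure.isProbabilityMeasure_map (mZ i j).aemeasurable
  have hc : (MeasurableEquiv.curry ι κ ℝ) ∘ (fun ω p ↦ Z p.1 p.2 ω) = fun ω i j ↦ Z i j ω := by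
    ext; simp [Function.curry]
  rw [iIndepFun_iff_map_fun_eq_infinitePi_map (by fun_prop), ← hc,
    ← Measure.map_map (by fun_prop) (by fun_prop),
    (iIndepFun_iff_map_fun_eq_infinitePi_map (by fun_prop)).1 h,
    Measure.infinitePi_map_curry (fun i j ↦ P.map (Z i j))]
  congr 1
  funext i
  have hi : iIndepFun (Z i) P := h.precomp (g := fun j => (i, j)) (Prod.mk_right_injective i)
  rw [(iIndepFun_iff_map_fun_eq_infinitePi_map (by fun_prop)).1 hi]

lemma indep_mul_aux {ι Ω : Type*} [MeasurableSpace Ω] {P : Measure Ω}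
    {X Y : ι → Ω → ℝ} (mX : ∀ i, Measurable (X i)) (mY : ∀ i, Measurable (Y i))
    (h : iIndepFun (Sum.elim X Y) P) :
    iIndepFun (fun i ω => X i ω * Y i ω) P := by
  let g : ι × Bool → ι ⊕ ι := fun p => bif p.2 then Sum.inr p.1 else Sum.inl p.1
  have hg : Function.Injective g := by
    rintro ⟨i, _ | _⟩ ⟨j, _ | _⟩ <;> simp [g]
  have h1 := h.precomp hg
  have h2 := indep_curry_aux (Z := fun i b => Sum.elim X Y (g (i, b)))
    (by rintro i (_ | _) <;> simp [g, mX, mY]) h1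
  exact h2.comp (fun _ f => f false * f true) (fun _ => by fun_prop)

/-- Concentration of the inner product of two sparse Gaussian vectors: if
`X₁, …, X_m, Y₁, …, Y_m` are `2m` jointly independent Gaussians with mean `0` and
variance `1/m`, then for every `t ∈ [0,1]`,
`Pr(|∑ X_i·Y_i| ≥ t) ≤ 2·exp(−m·t²/(4 + 2t))`. -/
theorem sum_mul_gaussian_concentration
    {Ω : Type*} [MeasureSpace Ω] [IsProbabilityMeasure (ℙ : Measure Ω)]
    (m : ℕ) (hm : 1 ≤ m) (X Y : Fin m → Ω → ℝ)
    (hmeasX : ∀ i, Measurable (X i)) (hmeasY : ∀ i, Measurable (Y i))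
    (hindep : iIndepFun
      (Sum.elim X Y) ℙ)
    (hlawX : ∀ i, Measure.map (X i) ℙ = gaussianReal 0 ((m : ℝ≥0))⁻¹)
    (hlawY : ∀ i, Measure.map (Y i) ℙ = gaussianReal 0 ((m : ℝ≥0))⁻¹)
    (t : ℝ) (ht : t ∈ Set.Icc (0 : ℝ) 1) :
    ℙ {ω | t ≤ |∑ i, X i ω * Y i ω|} ≤
      ENNReal.ofReal (2 * Real.exp (-(m * t ^ 2) / (4 + 2 * t))) := by
  obtain ⟨ht0, ht1⟩ := ht
  have hm0 : (0 : ℝ) < m := by exact_mod_cast hm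
  have hv : ((m : ℝ≥0))⁻¹ ≠ 0 := by
    have : m ≠ 0 := by omega
    simpa using this
  set W : Fin m → Ω → ℝ := fun i ω => X i ω * Y i ω with hW
  have hWm : ∀ i, Measurable (W i) := fun i => (hmeasX i).mul (hmeasY i)
  have hWi : iIndepFun W ℙ := indep_mul_aux hmeasX hmeasY hindep
  have hXY : ∀ i, IndepFun (X i) (Y i) ℙ := fun i =>
    hindep.indepFun (i := Sum.inl i) (j := Sum.inr i) (by simp)
  have hx : ∀ s : ℝ, s ^ 2 = (m * t / 2) ^ 2 →
      (((m : ℝ≥0)⁻¹ : ℝ≥0) : ℝ) * ((((m : ℝ≥0)⁻¹ : ℝ≥0) : ℝ) * s ^ 2) = t ^ 2 / 4 := by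
    intro s hs
    rw [hs]
    push_cast
    field_simp
    norm_num
  have hone : ∀ s : ℝ, s ^ 2 = (m * t / 2) ^ 2 →
      Integrable (fun ω => rexp (s * (∑ i, W i) ω)) ℙ ∧
      mgf (∑ i, W i) ℙ s ≤ rexp (m * (t ^ 2 / 4)) := by
    intro s hs
    have hb : 0 < 1 - (((m : ℝ≥0)⁻¹ : ℝ≥0) : ℝ) * ((((m : ℝ≥0)⁻¹ : ℝ≥0) : ℝ) * s ^ 2) := by
      rw [hx s hs]; nlinarith
    have hmg := fun i => mgf_mul_aux (hmeasX i) (hmeasY i) (hXY i) hv (hlawX i) (hlawY i) hb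
    refine ⟨hWi.integrable_exp_mul_sum hWm fun i _ => (hmg i).1, ?_⟩
    rw [hWi.mgf_sum hWm]
    calc ∏ i, mgf (W i) ℙ s ≤ ∏ _i : Fin m, rexp (t ^ 2 / 4) := by
          refine Finset.prod_le_prod (fun i _ => mgf_nonneg) fun i _ => ?_
          rw [(hmg i).2, hx s hs]
          exact sqrt_bound_aux (by positivity) (by nlinarith)
      _ = _ := by simp [Real.exp_nat_mul]
  have hfin : rexp (-(m * t / 2) * t) * rexp (m * (t ^ 2 / 4)) ≤
      rexp (-(m * t ^ 2) / (4 + 2 * t)) := by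
    rw [← Real.exp_add, Real.exp_le_exp, le_div_iff₀ (by positivity)]
    have : 0 ≤ m * t ^ 3 := by positivity
    nlinarith
  obtain ⟨i1, b1⟩ := hone (m * t / 2) rfl
  obtain ⟨i2, b2⟩ := hone (-(m * t / 2)) (by ring)
  have hst : 0 ≤ m * t / 2 := by positivity
  have u1 : (ℙ : Measure Ω).real {ω | t ≤ (∑ i, W i) ω} ≤ rexp (-(m * t ^ 2) / (4 + 2 * t)) :=
    (measure_ge_le_exp_mul_mgf t hst i1).trans
      ((mul_le_mul_of_nonneg_left b1 (Real.exp_pos _).le).trans hfin)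
  have u2 : (ℙ : Measure Ω).real {ω | (∑ i, W i) ω ≤ -t} ≤ rexp (-(m * t ^ 2) / (4 + 2 * t)) := by
    refine (measure_le_le_exp_mul_mgf (-t) (by linarith) i2).trans
      ((mul_le_mul_of_nonneg_left b2 (Real.exp_pos _).le).trans (le_trans (le_of_eq ?_) hfin))
    congr 2
    ring
  have hsub : {ω | t ≤ |∑ i, X i ω * Y i ω|} ⊆
      {ω | t ≤ (∑ i, W i) ω} ∪ {ω | (∑ i, W i) ω ≤ -t} := by
    intro ω hω
    have hω' : t ≤ |∑ i, X i ω * Y i ω| := hω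
    rw [le_abs] at hω'
    simp only [Set.mem_union, Set.mem_setOf_eq, Finset.sum_apply, hW]
    rcases hω' with h | h
    · exact Or.inl h
    · exact Or.inr (by linarith)
  rw [← ofReal_measureReal (measure_ne_top _ _)]
  refine ENNReal.ofReal_le_ofReal ?_
  calc _ ≤ (ℙ : Measure Ω).real ({ω | t ≤ (∑ i, W i) ω} ∪ {ω | (∑ i, W i) ω ≤ -t}) :=
        measureReal_mono hsub
    _ ≤ _ := measureReal_union_le _ _
    _ ≤ _ := by linarith
end

section
/- Fix k ∈ (0,1], δ_K ∈ (0,1) and a natural number K ≥ 1. There exist constants c₁ > 0 and c₂ > 0, depending only on δ_K, K and k, with the following property. Let n > 2 and m be natural numbers, let s = ⌈k·m⌉ ≥ 1, and for each column index j ∈ {1,…,n} let S_j ⊆ {1,…,m} be a set of exactly s row indices. Let Φ be the random m×n matrix whose entries Φ_{ij} for i ∈ S_j are jointly independent Gaussian random variables with mean 0 and variance 1/s, and whose entries Φ_{ij} for i ∉ S_j are 0 (a sparse Gaussian matrix with support sets S_j). If m > c₂·ln n, then Φ satisfies RIP(K, δ_K) with probability at least 1 − exp(−c₁·m). -/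
open Matrix MeasureTheory ProbabilityTheory Real
open scoped NNReal ENNReal

/-- A matrix `Φ ∈ ℝ^{m×n}` satisfies RIP(K, δ) if
`(1−δ)‖α‖₂² ≤ ‖Φα‖₂² ≤ (1+δ)‖α‖₂²` for every vector `α` with at most `K` nonzero entries. -/
def RIP {α β : Type*} [Fintype α] [Fintype β] (Φ : Matrix α β ℝ) (K : ℕ) (δ : ℝ) : Prop :=
  ∀ v : β → ℝ, (Finset.univ.filter fun j => v j ≠ 0).card ≤ K →
    (1 - δ) * (∑ j, v j ^ 2) ≤ ∑ i, (Φ.mulVec v i) ^ 2 ∧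
      ∑ i, (Φ.mulVec v i) ^ 2 ≤ (1 + δ) * (∑ j, v j ^ 2)

lemma curry_indep {Ω ι : Type*} [MeasurableSpace Ω] {P : Measure Ω} {X : ι → Bool → Ω → ℝ}
    (mX : ∀ i b, Measurable (X i b))
    (h : iIndepFun (fun (p : (_ : ι) × Bool) ω => X p.1 p.2 ω) P) :
    iIndepFun (fun i ω => (X i · ω)) P := by
  have := h.isProbabilityMeasure
  have : ∀ i j, IsProbabilityMeasure (P.map (X i j)) :=
    fun i j ↦ Measure.isProbabilityMeasure_map (mX i j).aemeasurable
  have : ∀ i, IsProbabilityMeasure (P.map (fun ω ↦ (X i · ω))) :=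
    fun i ↦ Measure.isProbabilityMeasure_map (Measurable.aemeasurable (by fun_prop))
  have h2 : ∀ i, iIndepFun (X i) P := fun i =>
    h.precomp (g := fun b : Bool => (⟨i, b⟩ : (_ : ι) × Bool)) (by intro a b; simp)
  have e : (MeasurableEquiv.piCurry (fun (_ : ι) (_ : Bool) => ℝ)) ∘ (fun ω p ↦ X p.1 p.2 ω)
      = fun ω i j ↦ X i j ω := by
    ext; simp [Sigma.curry]
  have e' := (iIndepFun_iff_map_fun_eq_infinitePi_map (by fun_prop)).1 h
  rw [iIndepFun_iff_map_fun_eq_infinitePi_map (by fun_prop), ← e,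
    ← Measure.map_map (by fun_prop) (by fun_prop), e',
    Measure.infinitePi_map_piCurry (fun i j ↦ P.map (X i j))]
  congrm Measure.infinitePi fun i ↦ ?_
  rw [(iIndepFun_iff_map_fun_eq_infinitePi_map (by fun_prop)).1 (h2 i)]

lemma exists_t (ν : Measure ℝ) [IsProbabilityMeasure ν]
    (h0 : 0 ∈ interior (integrableExpSet id ν)) (hmean : ∫ x, x ∂ν = 0) {ε : ℝ} (hε : 0 < ε) :
    ∃ t > 0, t ∈ integrableExpSet id ν ∧ mgf id ν t * exp (-t * ε) < 1 := by
  have hd : HasDerivAt (mgf id ν) 0 0 := by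
    have := hasDerivAt_mgf h0
    simpa [hmean] using this
  have hd2 : HasDerivAt (fun t => mgf id ν t * exp (-t * ε)) (-ε) 0 := by
    have h3 : HasDerivAt (fun t : ℝ => exp (-t * ε)) (-ε) 0 := by
      have := (((hasDerivAt_id (0:ℝ)).neg).mul_const ε).exp
      simpa using this
    have := hd.fun_mul h3
    simpa using this
  have hn := hd2.tendsto_slope.mono_left (nhdsWithin_mono 0 (s := Set.Ioi (0:ℝ)) (by
    intro x hx; exact ne_of_gt hx))
  have e1 := hn.eventually (gt_mem_nhds (show -ε < 0 by linarith))
  have e2 : ∀ᶠ t in nhdsWithin (0:ℝ) (Set.Ioi 0), t ∈ integrableExpSet id ν :=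
    nhdsWithin_le_nhds (mem_interior_iff_mem_nhds.1 h0)
  obtain ⟨t, h1, h2, h3⟩ := (e1.and (e2.and self_mem_nhdsWithin)).exists
  refine ⟨t, h3, h2, ?_⟩
  have h3' : 0 < t := h3
  simp only [slope_def_field, sub_zero] at h1
  rw [div_neg_iff] at h1
  simp at h1
  rcases h1 with h1 | h1
  · linarith
  · simpa using h1.1

lemma chernoff (ν : Measure ℝ) [IsProbabilityMeasure ν]
    (h0 : 0 ∈ interior (integrableExpSet id ν)) (hmean : ∫ x, x ∂ν = 0) {ε : ℝ} (hε : 0 < ε) :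
    ∃ ρ, 0 < ρ ∧ ρ < 1 ∧ ∀ (Ω : Type) (_ : MeasurableSpace Ω) (P : Measure Ω) (ι : Type)
      (_ : Fintype ι) (X : ι → Ω → ℝ) (s : ℕ), iIndepFun X P → (∀ i, Measurable (X i)) →
      (∀ i, P.map (X i) = ν) → Fintype.card ι ≤ s →
      P.real {ω | ε * s ≤ ∑ i, X i ω} ≤ ρ ^ s := by
  obtain ⟨t, ht, hti, h1⟩ := exists_t ν h0 hmean hε
  refine ⟨max (mgf id ν t * exp (-t * ε)) (exp (-t * ε)), by positivity, ?_, ?_⟩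
  · rw [max_lt_iff]
    refine ⟨h1, ?_⟩
    rw [exp_lt_one_iff]
    nlinarith
  intro Ω _ P ι _ X s hX mX hl hs
  have := hX.isProbabilityMeasure
  have hint : ∀ i ∈ Finset.univ, Integrable (fun ω => exp (t * X i ω)) P := by
    intro i _
    have h : Integrable (fun x => exp (t * id x)) (P.map (X i)) := by rw [hl]; exact hti
    exact h.comp_measurable (mX i)
  have hb := measure_ge_le_exp_mul_mgf (X := ∑ i, X i) (μ := P) (ε * s) ht.le
    (hX.integrable_exp_mul_sum mX hint)
  rw [hX.mgf_sum mX] at hb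
  have hm : ∀ i, mgf (X i) P t = mgf id ν t := by
    intro i; rw [← hl i, mgf_id_map (mX i).aemeasurable]
  simp only [hm, Finset.prod_const, Finset.card_univ, Finset.sum_apply] at hb
  refine hb.trans ?_
  obtain ⟨r, rfl⟩ := Nat.exists_eq_add_of_le hs
  set N := Fintype.card ι
  have hM : 0 ≤ mgf id ν t := mgf_nonneg
  calc exp (-t * (ε * ((N + r : ℕ) : ℝ))) * mgf id ν t ^ N
      = (mgf id ν t * exp (-t * ε)) ^ N * exp (-t * ε) ^ r := by
        rw [mul_pow, ← exp_nat_mul, ← exp_nat_mul, mul_assoc, ← exp_add, mul_comm]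
        congr 2
        push_cast; ring
    _ ≤ _ := by
        rw [pow_add]
        gcongr
        · exact le_max_left _ _
        · exact le_max_right _ _

lemma chernoff_abs (ν : Measure ℝ) [IsProbabilityMeasure ν]
    (h0 : 0 ∈ interior (integrableExpSet id ν)) (hmean : ∫ x, x ∂ν = 0) {ε : ℝ} (hε : 0 < ε) :
    ∃ ρ, 0 < ρ ∧ ρ < 1 ∧ ∀ (Ω : Type) (_ : MeasurableSpace Ω) (P : Measure Ω) (ι : Type)
      (_ : Fintype ι) (X : ι → Ω → ℝ) (s : ℕ), iIndepFun X P → (∀ i, Measurable (X i)) →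
      (∀ i, P.map (X i) = ν) → Fintype.card ι ≤ s →
      P.real {ω | ε * s ≤ |∑ i, X i ω|} ≤ 2 * ρ ^ s := by
  obtain ⟨a, a0, a1, ha⟩ := chernoff ν h0 hmean hε
  have i1 : IsProbabilityMeasure (ν.map (fun x => -x)) :=
    Measure.isProbabilityMeasure_map (by fun_prop)
  have e : integrableExpSet id (ν.map (fun x => -x)) = (Neg.neg) ⁻¹' (integrableExpSet id ν) := by
    ext t
    simp only [integrableExpSet, Set.mem_preimage, Set.mem_ofPred_eq]
    rw [integrable_map_measure (by fun_prop) (by fun_prop)]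
    simp [Function.comp_def]
  have h0' : 0 ∈ interior (integrableExpSet id (ν.map (fun x => -x))) := by
    rw [e, mem_interior_iff_mem_nhds]
    apply continuous_neg.continuousAt.preimage_mem_nhds
    rw [neg_zero]; exact mem_interior_iff_mem_nhds.1 h0
  have hmean' : ∫ x, x ∂(ν.map (fun x => -x)) = 0 := by
    rw [integral_map (by fun_prop) (by fun_prop), integral_neg, hmean, neg_zero]
  obtain ⟨b, b0, b1, hb⟩ := chernoff _ h0' hmean' hε
  refine ⟨max a b, by positivity, max_lt a1 b1, ?_⟩
  intro Ω _ P ι _ X s hX mX hl hs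
  have := hX.isProbabilityMeasure
  have A := ha Ω _ P ι _ X s hX mX hl hs
  have B := hb Ω _ P ι _ (fun i ω => - X i ω) s
    (hX.comp (fun _ x => -x) (fun _ => measurable_neg)) (fun i => (mX i).neg)
    (fun i => by rw [← hl i, Measure.map_map (by fun_prop) (mX i)]; rfl) hs
  have hsub : {ω | ε * s ≤ |∑ i, X i ω|} ⊆ {ω | ε * s ≤ ∑ i, X i ω} ∪
      {ω | ε * s ≤ ∑ i, - X i ω} := by
    intro ω hω
    simp only [Set.mem_ofPred_eq, le_abs, Set.mem_union, Finset.sum_neg_distrib] at *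
    exact hω
  calc _ ≤ _ := measureReal_mono hsub
    _ ≤ _ := measureReal_union_le _ _
    _ ≤ a ^ s + b ^ s := add_le_add A B
    _ ≤ max a b ^ s + max a b ^ s := by
        gcongr
        · exact le_max_left _ _
        · exact le_max_right _ _
    _ = _ := by ring

lemma gauss_int {t : ℝ} (ht : t < 1 / 2) :
    Integrable (fun x : ℝ => exp (t * x ^ 2)) (gaussianReal 0 1) := by
  rw [gaussianReal_of_var_ne_zero _ one_ne_zero,
    integrable_withDensity_iff_integrable_smul' (by fun_prop) (by simp [gaussianPDF])]
  have := (integrable_exp_neg_mul_sq (b := 1 / 2 - t) (by linarith)).const_mul ((√(2 * π))⁻¹)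
  refine this.congr (Filter.Eventually.of_forall fun x => ?_)
  simp only [toReal_gaussianPDF, gaussianPDFReal_def, smul_eq_mul]
  rw [mul_assoc, ← exp_add]
  simp
  left
  ring

lemma ioo_mem (ν : Measure ℝ) (h : ∀ t : ℝ, |t| < 1/2 → t ∈ integrableExpSet id ν) :
    0 ∈ interior (integrableExpSet id ν) := by
  rw [mem_interior_iff_mem_nhds]
  filter_upwards [Ioo_mem_nhds (show (-(1/2):ℝ) < 0 by norm_num) (show (0:ℝ) < 1/2 by norm_num)]
    with t ht
  exact h t (abs_lt.2 ht)

noncomputable def nuSq : Measure ℝ := (gaussianReal 0 1).map (fun x => x ^ 2 - 1)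
noncomputable def nuMul : Measure ℝ :=
  ((gaussianReal 0 1).prod (gaussianReal 0 1)).map (fun p => p.1 * p.2)

instance : IsProbabilityMeasure nuSq := Measure.isProbabilityMeasure_map (by fun_prop)
instance : IsProbabilityMeasure nuMul := Measure.isProbabilityMeasure_map (by fun_prop)

lemma nuSq_int : 0 ∈ interior (integrableExpSet id nuSq) := by
  apply ioo_mem
  intro t ht
  simp only [integrableExpSet, Set.mem_ofPred_eq, nuSq]
  rw [integrable_map_measure (by fun_prop) (by fun_prop)]
  refine ((gauss_int (lt_of_abs_lt ht)).const_mul (exp (-t))).congr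
    (Filter.Eventually.of_forall fun x => ?_)
  simp only [Function.comp, id]
  rw [← exp_add]; congr 1; ring

lemma nuSq_mean : ∫ x, x ∂nuSq = 0 := by
  have hv := variance_fun_id_gaussianReal (μ := 0) (v := 1)
  rw [variance_eq_integral (by fun_prop)] at hv
  simp at hv
  have hi : Integrable (fun x : ℝ => x ^ 2) (gaussianReal 0 1) := by
    by_contra h
    rw [integral_undef h] at hv
    norm_num at hv
  rw [nuSq, integral_map (by fun_prop) (by fun_prop), integral_sub hi (by fun_prop), hv]
  simp

lemma nuMul_int : 0 ∈ interior (integrableExpSet id nuMul) := by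
  apply ioo_mem
  intro t ht
  simp only [integrableExpSet, Set.mem_ofPred_eq, nuMul]
  rw [integrable_map_measure (by fun_prop) (by fun_prop)]
  have hg := gauss_int (t := |t| / 2) (by linarith [abs_nonneg t])
  refine (hg.mul_prod hg).mono' (by fun_prop) (Filter.Eventually.of_forall fun x => ?_)
  simp only [Function.comp, id, norm_eq_abs, abs_exp]
  rw [← exp_add]
  gcongr
  have h1 : t * (x.1 * x.2) ≤ |t| * |x.1 * x.2| := by rw [← abs_mul]; exact le_abs_self _
  have h2 : |x.1 * x.2| ≤ (x.1 ^ 2 + x.2 ^ 2) / 2 := by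
    rw [abs_le]; constructor <;> nlinarith [sq_nonneg (x.1 + x.2), sq_nonneg (x.1 - x.2)]
  nlinarith [abs_nonneg t]

lemma nuMul_mean : ∫ x, x ∂nuMul = 0 := by
  rw [nuMul, integral_map (by fun_prop) (by fun_prop),
    integral_prod_mul (fun x : ℝ => x) (fun x : ℝ => x)]
  simp

lemma rip_of_gram {m n : ℕ} (A : Matrix (Fin m) (Fin n) ℝ) (K : ℕ) (hK : 1 ≤ K) (δ : ℝ)
    (hδ : 0 < δ)
    (h : ∀ j l, |∑ i, A i j * A i l - if j = l then 1 else 0| ≤ δ / K) : RIP A K δ := by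
  intro v hv
  have hK' : (0 : ℝ) < K := by exact_mod_cast hK
  have key : |∑ i, (A.mulVec v i) ^ 2 - ∑ j, v j ^ 2| ≤ δ * ∑ j, v j ^ 2 := by
    have e1 : ∑ i, (A.mulVec v i) ^ 2 - ∑ j, v j ^ 2
        = ∑ j, ∑ l, v j * v l * (∑ i, A i j * A i l - if j = l then 1 else 0) := by
      simp only [mul_sub, Finset.sum_sub_distrib]
      congr 1
      · simp only [Matrix.mulVec, dotProduct, sq, Finset.mul_sum, Finset.sum_mul]
        rw [Finset.sum_comm]
        refine Finset.sum_congr rfl fun j _ => ?_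
        rw [Finset.sum_comm]
        refine Finset.sum_congr rfl fun l _ => Finset.sum_congr rfl fun i _ => ?_
        ring
      · simp [sq]
    have e2 : ∑ j, |v j| = ∑ j ∈ Finset.univ.filter (fun j => v j ≠ 0), |v j| := by
      rw [Finset.sum_filter]
      refine Finset.sum_congr rfl fun j _ => ?_
      by_cases hj : v j = 0 <;> simp [hj]
    have e3 : (∑ j, |v j|) ^ 2 ≤ K * ∑ j, v j ^ 2 := by
      rw [e2]
      refine sq_sum_le_card_mul_sum_sq.trans ?_
      gcongr
      simp only [sq_abs]
      exact Finset.sum_le_univ_sum_of_nonneg fun j => sq_nonneg _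
    rw [e1]
    calc _ ≤ ∑ j, ∑ l, |v j| * |v l| * (δ / K) := by
          refine (Finset.abs_sum_le_sum_abs _ _).trans (Finset.sum_le_sum fun j _ => ?_)
          refine (Finset.abs_sum_le_sum_abs _ _).trans (Finset.sum_le_sum fun l _ => ?_)
          rw [abs_mul, abs_mul]
          gcongr
          exact h j l
      _ = (∑ j, |v j|) ^ 2 * (δ / K) := by
          rw [sq, Finset.sum_mul_sum]; simp only [Finset.sum_mul]
      _ ≤ (K * ∑ j, v j ^ 2) * (δ / K) := by gcongr
      _ = _ := by field_simp
  rw [abs_le] at key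
  constructor <;> nlinarith [key.1, key.2]

lemma gram_prob {ε : ℝ} (hε : 0 < ε) : ∃ ρ, 0 < ρ ∧ ρ < 1 ∧
      ∀ (n m : ℕ) (s : ℕ), 1 ≤ s →
      ∀ (Ω : Type) (_ : MeasurableSpace Ω) (P : Measure Ω),
      ∀ S : Fin n → Finset (Fin m), (∀ j, (S j).card = s) →
      ∀ Φ : Ω → Matrix (Fin m) (Fin n) ℝ,
        (∀ i j, Measurable fun ω => Φ ω i j) →
        iIndepFun
          (fun (p : {p : Fin m × Fin n // p.1 ∈ S p.2}) ω => Φ ω p.val.1 p.val.2) P →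
        (∀ p : {p : Fin m × Fin n // p.1 ∈ S p.2},
          Measure.map (fun ω => Φ ω p.val.1 p.val.2) P = gaussianReal 0 ((s : ℝ≥0))⁻¹) →
        (∀ ω i j, i ∉ S j → Φ ω i j = 0) → ∀ j l,
        P.real {ω | ε ≤ |∑ i, Φ ω i j * Φ ω i l - if j = l then 1 else 0|} ≤ 2 * ρ ^ s := by
  obtain ⟨a, a0, a1, ha⟩ := chernoff_abs nuSq nuSq_int nuSq_mean hε
  obtain ⟨b, b0, b1, hb⟩ := chernoff_abs nuMul nuMul_int nuMul_mean hε
  refine ⟨max a b, by positivity, max_lt a1 b1, ?_⟩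
  intro n m s hs Ω _ P S hS Φ mΦ hind hlaw hz j l
  have hs' : (0 : ℝ) < s := by exact_mod_cast hs
  have := hind.isProbabilityMeasure
  have hlaw' : ∀ i j, i ∈ S j → P.map (fun ω => √s * Φ ω i j) = gaussianReal 0 1 := by
    intro i j hij
    have h1 := hlaw ⟨(i, j), hij⟩
    have h2 : P.map (fun ω => √s * Φ ω i j) = (P.map (fun ω => Φ ω i j)).map (√s * ·) := by
      rw [Measure.map_map (by fun_prop) (mΦ i j)]; rfl
    simp only at h1
    rw [h2, h1, gaussianReal_map_const_mul]
    congr 1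
    · simp
    · ext
      simp [hs'.ne']
  by_cases hjl : j = l
  · subst hjl
    have hi : iIndepFun (fun (i : S j) ω => (√s * Φ ω i j) ^ 2 - 1) P := by
      have := hind.precomp (g := fun i : S j =>
        (⟨(i.1, j), i.2⟩ : {p : Fin m × Fin n // p.1 ∈ S p.2})) (by
          intro x y hxy; ext; simp at hxy; simp [hxy])
      exact this.comp (fun _ x => (√s * x) ^ 2 - 1) (fun _ => by fun_prop)
    have H := ha Ω _ P (S j) inferInstance _ s hi (fun i => by fun_prop) (fun i => by
      rw [nuSq, ← hlaw' i j i.2, Measure.map_map (by fun_prop) (by fun_prop)]; rfl)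
      (by simp [hS])
    refine le_trans (le_of_eq ?_) (H.trans ?_)
    · congr 1
      ext ω
      simp only [Set.mem_ofPred_eq, if_true]
      have e : ∑ i : S j, ((√s * Φ ω i j) ^ 2 - 1) = s * (∑ i, Φ ω i j * Φ ω i j - 1) := by
        rw [Finset.sum_coe_sort (S j) (fun i => (√s * Φ ω i j) ^ 2 - 1)]
        simp only [Finset.sum_sub_distrib, mul_pow, Real.sq_sqrt hs'.le, ← Finset.mul_sum]
        rw [← Finset.sum_subset (Finset.subset_univ (S j)) (fun i _ hi => by simp [hz ω i j hi])]
        simp [hS, mul_sub, sq]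
      rw [e, abs_mul, abs_of_pos hs', mul_comm ε, mul_le_mul_iff_right₀ hs']
    · gcongr
      exact le_max_left _ _
  · let T := S j ∩ S l
    let f : T → Bool → {p : Fin m × Fin n // p.1 ∈ S p.2} := fun i c =>
      if c then ⟨(i.1, j), (Finset.mem_inter.1 i.2).1⟩ else ⟨(i.1, l), (Finset.mem_inter.1 i.2).2⟩
    have hf : Function.Injective (fun p : (_ : T) × Bool => f p.1 p.2) := by
      rintro ⟨x, c⟩ ⟨y, d⟩ hxy
      cases c <;> cases d <;> simp [f, hjl, Ne.symm hjl] at hxy ⊢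
      all_goals exact hxy
    have hc := hind.precomp hf
    have hc2 := curry_indep (X := fun (i : T) c ω => Φ ω (f i c).1.1 (f i c).1.2)
      (fun i c => mΦ _ _) hc
    have hi : iIndepFun (fun (i : T) ω => (√s * Φ ω i j) * (√s * Φ ω i l)) P := by
      have := hc2.comp (fun _ x => (√s * x true) * (√s * x false)) (fun _ => by fun_prop)
      exact this
    have H := hb Ω _ P T inferInstance _ s hi (fun i => by fun_prop) (fun i => by
      have h1 : i.1 ∈ S j := (Finset.mem_inter.1 i.2).1
      have h2 : i.1 ∈ S l := (Finset.mem_inter.1 i.2).2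
      have hI : IndepFun (fun ω => Φ ω i j) (fun ω => Φ ω i l) P :=
        hind.indepFun (i := ⟨(i.1, j), h1⟩) (j := ⟨(i.1, l), h2⟩) (by simp [hjl])
      have hI2 : IndepFun (fun ω => √s * Φ ω i j) (fun ω => √s * Φ ω i l) P :=
        hI.comp (φ := (√s * ·)) (ψ := (√s * ·)) (by fun_prop) (by fun_prop)
      have hm := hI2.map_prod_eq_prod_map_map (by fun_prop) (by fun_prop)
      rw [hlaw' _ _ h1, hlaw' _ _ h2] at hm
      rw [nuMul, ← hm, Measure.map_map (by fun_prop) (by fun_prop)]; rfl)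
      (by
        simp only [Fintype.card_coe]
        exact (Finset.card_le_card Finset.inter_subset_left).trans (hS j).le)
    refine le_trans (le_of_eq ?_) (H.trans ?_)
    · congr 1
      ext ω
      simp only [Set.mem_ofPred_eq, hjl, if_false, sub_zero]
      have e : ∑ i : T, (√s * Φ ω i j) * (√s * Φ ω i l) = s * (∑ i, Φ ω i j * Φ ω i l) := by
        rw [Finset.sum_coe_sort T (fun i => (√s * Φ ω i j) * (√s * Φ ω i l)),
          ← Finset.sum_subset (Finset.subset_univ T) (fun i _ hi => ?_), Finset.mul_sum]
        · refine Finset.sum_congr rfl fun i _ => ?_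
          nth_rewrite 3 [← Real.mul_self_sqrt hs'.le]
          ring
        · by_cases h : i ∈ S j
          · have : i ∉ S l := fun h' => hi (Finset.mem_inter.2 ⟨h, h'⟩)
            simp [hz ω i l this]
          · simp [hz ω i j h]
      rw [e, abs_mul, abs_of_pos hs', mul_comm ε, mul_le_mul_iff_right₀ hs']
    · gcongr
      exact le_max_right _ _

/-- A random `m×n` sparse Gaussian matrix — whose entries at positions `(i,j)` with
`i ∈ S j` (where the support sets `S j` all have size `s = ⌈k·m⌉`) are jointly independent
Gaussians with mean `0` and variance `1/s`, and whose remaining entries are `0` — satisfies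
RIP(K, δ_K) with probability at least `1 − exp(−c₁·m)` provided `m > c₂·ln n`,
where the constants `c₁, c₂ > 0` depend only on `δ_K`, `K` and `k`. -/
theorem sparse_gaussian_rip (k δK : ℝ) (hk : k ∈ Set.Ioc (0 : ℝ) 1)
    (hδK : δK ∈ Set.Ioo (0 : ℝ) 1) (K : ℕ) (hK : 1 ≤ K) :
    ∃ c₁ c₂ : ℝ, 0 < c₁ ∧ 0 < c₂ ∧
      ∀ (n m : ℕ), 2 < n →
      ∀ s : ℕ, s = ⌈k * (m : ℝ)⌉₊ → 1 ≤ s →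
      ∀ (Ω : Type) (_ : MeasureSpace Ω), IsProbabilityMeasure (ℙ : Measure Ω) →
      ∀ S : Fin n → Finset (Fin m), (∀ j, (S j).card = s) →
      ∀ Φ : Ω → Matrix (Fin m) (Fin n) ℝ,
        (∀ i j, Measurable fun ω => Φ ω i j) →
        iIndepFun
          (fun (p : {p : Fin m × Fin n // p.1 ∈ S p.2}) ω => Φ ω p.val.1 p.val.2) ℙ →
        (∀ p : {p : Fin m × Fin n // p.1 ∈ S p.2},
          Measure.map (fun ω => Φ ω p.val.1 p.val.2) ℙ = gaussianReal 0 ((s : ℝ≥0))⁻¹) →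
        (∀ ω i j, i ∉ S j → Φ ω i j = 0) →
        c₂ * Real.log n < (m : ℝ) →
        ENNReal.ofReal (1 - Real.exp (-c₁ * m)) ≤ ℙ {ω | RIP (Φ ω) K δK} := by
  obtain ⟨hk0, hk1⟩ := hk
  obtain ⟨hδ0, hδ1⟩ := hδK
  have hK' : (0 : ℝ) < K := by exact_mod_cast hK
  obtain ⟨ρ, ρ0, ρ1, H⟩ := gram_prob (ε := δK / K) (by positivity)
  have hlog : Real.log ρ < 0 := Real.log_neg ρ0 ρ1
  set a : ℝ := k * (-Real.log ρ) with ha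
  have ha0 : 0 < a := mul_pos hk0 (by linarith)
  refine ⟨a / 2, 6 / a, by positivity, by positivity, ?_⟩
  intro n m hn s hs hs1 Ω _ hP S hS Φ mΦ hind hlaw hz hm
  have G := H n m s hs1 Ω _ ℙ S hS Φ mΦ hind hlaw hz
  let B : Fin n × Fin n → Set Ω := fun p =>
    {ω | δK / K ≤ |∑ i, Φ ω i p.1 * Φ ω i p.2 - if p.1 = p.2 then 1 else 0|}
  have mB : MeasurableSet (⋃ p, B p) := by
    refine MeasurableSet.iUnion fun p => measurableSet_le (by fun_prop) ?_
    apply Measurable.abs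
    fun_prop
  have hsub : (⋃ p, B p)ᶜ ⊆ {ω | RIP (Φ ω) K δK} := by
    intro ω hω
    refine rip_of_gram _ K hK δK hδ0 fun j l => ?_
    by_contra hcon
    exact hω (Set.mem_iUnion.2 ⟨(j, l), (not_le.1 hcon).le⟩)
  have hBsum : (ℙ : Measure Ω).real (⋃ p, B p) ≤ (n : ℝ) ^ 2 * (2 * ρ ^ s) := by
    calc _ ≤ ∑ p, (ℙ : Measure Ω).real (B p) := measureReal_iUnion_fintype_le _
      _ ≤ ∑ p : Fin n × Fin n, 2 * ρ ^ s := Finset.sum_le_sum fun p _ => G p.1 p.2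
      _ = _ := by simp [sq]
  have hn' : (2 : ℝ) < n := by exact_mod_cast hn
  have hρs : ρ ^ s ≤ exp (-(a * m)) := by
    rw [← Real.exp_log ρ0, ← exp_nat_mul]
    apply exp_le_exp.2
    have : k * m ≤ s := by rw [hs]; exact Nat.le_ceil _
    rw [ha]; nlinarith
  have hn3 : (n : ℝ) ^ 2 * 2 ≤ exp (a / 2 * m) := by
    calc (n : ℝ) ^ 2 * 2 ≤ (n : ℝ) ^ 3 := by
          rw [pow_succ _ 2]; gcongr
      _ = exp (3 * Real.log n) := by
          rw [show (3 : ℝ) = ((3 : ℕ) : ℝ) by norm_num, exp_nat_mul, Real.exp_log (by linarith)]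
      _ ≤ _ := by
          apply exp_le_exp.2
          rw [div_mul_eq_mul_div, div_lt_iff₀ ha0] at hm
          nlinarith
  have hfin : (ℙ : Measure Ω).real (⋃ p, B p) ≤ exp (-(a / 2) * m) := by
    calc _ ≤ (n : ℝ) ^ 2 * (2 * ρ ^ s) := hBsum
      _ = ((n : ℝ) ^ 2 * 2) * ρ ^ s := by ring
      _ ≤ exp (a / 2 * m) * exp (-(a * m)) := by gcongr
      _ = _ := by rw [← exp_add]; congr 1; ring
  refine le_trans ?_ (measure_mono hsub)
  rw [← ofReal_measureReal, probReal_compl_eq_one_sub mB]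
  apply ENNReal.ofReal_le_ofReal
  linarith
end
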